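/- Let H be a real inner product space, let B : H → H be a symmetric continuous linear operator, let s be a positive integer, a : Fin s → Fin s → ℝ and b : Fin s → ℝ Runge–Kutta coefficients with bᵢ aᵢⱼ + bⱼ aⱼᵢ = bᵢ bⱼ and bᵢ ≥ 0 for all i, j, and let N₁, …, N_s : H → H be negative semi-definite continuous linear operators. Let Δt > 0, Ψⁿ ∈ H, and suppose k₁, …, k_s ∈ H satisfy kᵢ = Nᵢ(B(Ψⁿ + Δt ∑ⱼ aᵢⱼ kⱼ)) for all i, and set Ψⁿ⁺¹ = Ψⁿ + Δt ∑ᵢ bᵢ kᵢ. Then F(Ψⁿ⁺¹) ≤ F(Ψⁿ), where F(x) = (1/2)⟨x, B x⟩. -/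

import Mathlib

open scoped RealInnerProductSpace

/-- For coefficients satisfying the symplecticity condition, the quadratic form with weights
`b i * b j` of a symmetric array is twice the one with weights `b i * a i j`. -/
theorem sum_sum_mul_eq_two_mul_of_symplectic {ι R : Type*} [Fintype ι] [CommRing R]
    {a : ι → ι → R} {b : ι → R} (hab : ∀ i j, b i * a i j + b j * a j i = b i * b j)
    {G : ι → ι → R} (hG : ∀ i j, G i j = G j i) :
    ∑ i, ∑ j, b i * b j * G i j = 2 * ∑ i, ∑ j, b i * a i j * G i j := by
  have hswap : ∑ i, ∑ j, b j * a j i * G i j = ∑ i, ∑ j, b i * a i j * G i j := by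
    rw [Finset.sum_comm]
    simp_rw [hG]
  simp_rw [← hab, add_mul, Finset.sum_add_distrib]
  rw [hswap, two_mul]

/-- Expansion of the quadratic form of a symmetric operator. -/
theorem inner_add_smul_map_add_smul {H : Type*} [NormedAddCommGroup H] [InnerProductSpace ℝ H]
    {B : H →L[ℝ] H} (hB : ∀ x y : H, ⟪B x, y⟫ = ⟪x, B y⟫) (x y : H) (t : ℝ) :
    ⟪x + t • y, B (x + t • y)⟫ = ⟪x, B x⟫ + 2 * t * ⟪y, B x⟫ + t ^ 2 * ⟪y, B y⟫ := by
  have hxy : ⟪x, B y⟫ = ⟪y, B x⟫ := by rw [← hB, real_inner_comm]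
  simp only [map_add, map_smul, inner_add_left, inner_add_right, real_inner_smul_left,
    real_inner_smul_right, hxy]
  ring

theorem heq_rk_unconditional_energy_stability
    {H : Type*} [NormedAddCommGroup H] [InnerProductSpace ℝ H]
    (B : H →L[ℝ] H) (hB : ∀ x y : H, ⟪B x, y⟫ = ⟪x, B y⟫)
    (s : ℕ) (hs : 0 < s)
    (a : Fin s → Fin s → ℝ) (b : Fin s → ℝ)
    (hab : ∀ i j, b i * a i j + b j * a j i = b i * b j)
    (hb : ∀ i, 0 ≤ b i)
    (N : Fin s → (H →L[ℝ] H)) (hN : ∀ i, ∀ v : H, ⟪N i v, v⟫ ≤ 0)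
    (Δt : ℝ) (hΔt : 0 < Δt) (Ψn : H) (k : Fin s → H)
    (hstage : ∀ i, k i = N i (B (Ψn + Δt • ∑ j, a i j • k j)))
    (Ψnp1 : H) (hΨnp1 : Ψnp1 = Ψn + Δt • ∑ i, b i • k i)
    (F : H → ℝ) (hF : ∀ x : H, F x = (1/2) * ⟪x, B x⟫) :
    F Ψnp1 ≤ F Ψn := by
  have hsymm : ∀ i j, ⟪k i, B (k j)⟫ = ⟪k j, B (k i)⟫ := fun i j => by
    rw [← hB, real_inner_comm]
  have hstage_nonpos : ∀ i, ⟪k i, B Ψn⟫ + Δt * ∑ j, a i j * ⟪k i, B (k j)⟫ ≤ 0 := fun i => by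
    have h := hN i (B (Ψn + Δt • ∑ j, a i j • k j))
    rw [← hstage i] at h
    simpa only [map_add, map_smul, map_sum, inner_add_right, real_inner_smul_right,
      inner_sum] using h
  have hquad : ⟪∑ i, b i • k i, B (∑ i, b i • k i)⟫
      = 2 * ∑ i, ∑ j, b i * a i j * ⟪k i, B (k j)⟫ := by
    rw [← sum_sum_mul_eq_two_mul_of_symplectic hab hsymm]
    simp only [map_sum, map_smul, sum_inner, inner_sum, real_inner_smul_left,
      real_inner_smul_right, mul_assoc]
    exact Finset.sum_congr rfl fun i _ => Finset.sum_congr rfl fun j _ => by rw [hsymm j i]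
  have hdiss : ⟪∑ i, b i • k i, B Ψn⟫ + Δt * ∑ i, ∑ j, b i * a i j * ⟪k i, B (k j)⟫ ≤ 0 := by
    calc _ = ∑ i, b i * (⟪k i, B Ψn⟫ + Δt * ∑ j, a i j * ⟪k i, B (k j)⟫) := by
          simp only [sum_inner, real_inner_smul_left, mul_add, Finset.sum_add_distrib,
            Finset.mul_sum]
          congr 1
          exact Finset.sum_congr rfl fun i _ => Finset.sum_congr rfl fun j _ => by ring
      _ ≤ 0 := Finset.sum_nonpos fun i _ =>
          mul_nonpos_of_nonneg_of_nonpos (hb i) (hstage_nonpos i)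
  rw [hF, hF, hΨnp1, inner_add_smul_map_add_smul hB, hquad]
  nlinarith [mul_nonpos_of_nonneg_of_nonpos hΔt.le hdiss]
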